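/- Let X ∈ ℝ^{N×C}, let W ∈ ℝ^{C×C} have columns w_1,…,w_C, let P_1,…,P_C be N×N permutation matrices, and let Y = CSP_W(X) be the N×C matrix whose c-th column is P_c X w_c. Then r_{1,∞}(Y) ≤ √C · ‖W‖₁ · r_{1,∞}(X). -/

import Mathlib

open scoped BigOperators

/-- Maximum absolute column sum norm `‖X‖₁` of an `N × C` real matrix. -/
noncomputable def colNorm {N C : ℕ} (X : Matrix (Fin N) (Fin C) ℝ) : ℝ :=
  ⨆ c : Fin C, ∑ n : Fin N, |X n c|

/-- Maximum absolute row sum norm `‖X‖_∞` of an `N × C` real matrix. -/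
noncomputable def rowNorm {N C : ℕ} (X : Matrix (Fin N) (Fin C) ℝ) : ℝ :=
  ⨆ n : Fin N, ∑ c : Fin C, |X n c|

/-- Rank-one residual `r₁(X) = inf_x ‖X − 1_N x^⊤‖₁`. -/
noncomputable def r1 {N C : ℕ} (X : Matrix (Fin N) (Fin C) ℝ) : ℝ :=
  ⨅ x : Fin C → ℝ, colNorm (X - Matrix.of fun _ c => x c)

/-- Rank-one residual `r_∞(X) = inf_x ‖X − 1_N x^⊤‖_∞`. -/
noncomputable def rInf {N C : ℕ} (X : Matrix (Fin N) (Fin C) ℝ) : ℝ :=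
  ⨅ x : Fin C → ℝ, rowNorm (X - Matrix.of fun _ c => x c)

/-- `r_{1,∞}(X) = √(r₁(X) · r_∞(X))`. -/
noncomputable def r1Inf {N C : ℕ} (X : Matrix (Fin N) (Fin C) ℝ) : ℝ :=
  Real.sqrt (r1 X * rInf X)

/-- `P` is a permutation matrix. -/
def IsPermMatrix {N : ℕ} (P : Matrix (Fin N) (Fin N) ℝ) : Prop :=
  ∃ σ : Equiv.Perm (Fin N), ∀ i j, P i j = if i = σ j then 1 else 0

/-- The CSP operator: the `c`-th column of `CSP P W X` is `P_c X w_c`,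
where `w_c` is the `c`-th column of `W`. -/
noncomputable def CSP {N C : ℕ} (P : Fin C → Matrix (Fin N) (Fin N) ℝ)
    (W : Matrix (Fin C) (Fin C) ℝ) (X : Matrix (Fin N) (Fin C) ℝ) :
    Matrix (Fin N) (Fin C) ℝ :=
  Matrix.of fun n c => (P c).mulVec (X.mulVec fun r => W r c) n

theorem colNorm_nonneg {N C : ℕ} (X : Matrix (Fin N) (Fin C) ℝ) : 0 ≤ colNorm X :=
  Real.iSup_nonneg fun _ => Finset.sum_nonneg fun _ _ => abs_nonneg _

theorem rowNorm_nonneg {N C : ℕ} (X : Matrix (Fin N) (Fin C) ℝ) : 0 ≤ rowNorm X :=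
  Real.iSup_nonneg fun _ => Finset.sum_nonneg fun _ _ => abs_nonneg _

theorem sum_abs_le_colNorm {N C : ℕ} (X : Matrix (Fin N) (Fin C) ℝ) (c : Fin C) :
    ∑ n, |X n c| ≤ colNorm X :=
  le_ciSup (f := fun c => ∑ n, |X n c|) (Set.finite_range _).bddAbove c

theorem sum_abs_le_rowNorm {N C : ℕ} (X : Matrix (Fin N) (Fin C) ℝ) (n : Fin N) :
    ∑ c, |X n c| ≤ rowNorm X :=
  le_ciSup (f := fun n => ∑ c, |X n c|) (Set.finite_range _).bddAbove n

theorem abs_le_rowNorm {N C : ℕ} (X : Matrix (Fin N) (Fin C) ℝ) (n : Fin N) (c : Fin C) :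
    |X n c| ≤ rowNorm X :=
  (Finset.single_le_sum (f := fun c => |X n c|) (fun _ _ => abs_nonneg _)
    (Finset.mem_univ c)).trans (sum_abs_le_rowNorm X n)

theorem r1_nonneg {N C : ℕ} (X : Matrix (Fin N) (Fin C) ℝ) : 0 ≤ r1 X :=
  Real.iInf_nonneg fun _ => colNorm_nonneg _

theorem rInf_nonneg {N C : ℕ} (X : Matrix (Fin N) (Fin C) ℝ) : 0 ≤ rInf X :=
  Real.iInf_nonneg fun _ => rowNorm_nonneg _

theorem r1_le {N C : ℕ} (X : Matrix (Fin N) (Fin C) ℝ) (x : Fin C → ℝ) :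
    r1 X ≤ colNorm (X - Matrix.of fun _ c => x c) :=
  ciInf_le ⟨0, Set.forall_mem_range.2 fun _ => colNorm_nonneg _⟩ x

theorem rInf_le {N C : ℕ} (X : Matrix (Fin N) (Fin C) ℝ) (x : Fin C → ℝ) :
    rInf X ≤ rowNorm (X - Matrix.of fun _ c => x c) :=
  ciInf_le ⟨0, Set.forall_mem_range.2 fun _ => rowNorm_nonneg _⟩ x

theorem CSP_apply {N C : ℕ} {P : Fin C → Matrix (Fin N) (Fin N) ℝ}
    {σ : Fin C → Equiv.Perm (Fin N)} (hσ : ∀ c i j, P c i j = if i = σ c j then 1 else 0)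
    (W : Matrix (Fin C) (Fin C) ℝ) (X : Matrix (Fin N) (Fin C) ℝ) (n : Fin N) (c : Fin C) :
    CSP P W X n c = ∑ r, X ((σ c).symm n) r * W r c := by
  simp [CSP, Matrix.mulVec, dotProduct, hσ, ← Equiv.symm_apply_eq]

/-- Applying CSP commutes with subtracting a matrix with constant columns, up to replacing the row
vector `x` by `x W`. -/
theorem CSP_sub_const {N C : ℕ} {P : Fin C → Matrix (Fin N) (Fin N) ℝ}
    (hP : ∀ c, IsPermMatrix (P c)) (W : Matrix (Fin C) (Fin C) ℝ)
    (X : Matrix (Fin N) (Fin C) ℝ) (x : Fin C → ℝ) :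
    CSP P W X - Matrix.of (fun _ c => ∑ r, x r * W r c) =
      CSP P W (X - Matrix.of fun _ c => x c) := by
  choose σ hσ using hP
  ext n c
  simp [CSP_apply hσ, sub_mul]

theorem colNorm_CSP_le {N C : ℕ} {P : Fin C → Matrix (Fin N) (Fin N) ℝ}
    (hP : ∀ c, IsPermMatrix (P c)) (W : Matrix (Fin C) (Fin C) ℝ)
    (Z : Matrix (Fin N) (Fin C) ℝ) : colNorm (CSP P W Z) ≤ colNorm W * colNorm Z := by
  choose σ hσ using hP
  refine Real.iSup_le (fun c => ?_) (mul_nonneg (colNorm_nonneg _) (colNorm_nonneg _))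
  calc ∑ n, |CSP P W Z n c| = ∑ n, |∑ r, Z ((σ c).symm n) r * W r c| := by
        simp only [CSP_apply hσ]
    _ = ∑ n, |∑ r, Z n r * W r c| :=
        Equiv.sum_comp (σ c).symm fun n => |∑ r, Z n r * W r c|
    _ ≤ ∑ n, ∑ r, |Z n r| * |W r c| := by
        gcongr with n
        simpa only [abs_mul] using
          Finset.abs_sum_le_sum_abs (fun r => Z n r * W r c) Finset.univ
    _ = ∑ r, |W r c| * ∑ n, |Z n r| := by
        rw [Finset.sum_comm]
        simp only [Finset.mul_sum, mul_comm]
    _ ≤ ∑ r, |W r c| * colNorm Z := by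
        gcongr with r
        exact sum_abs_le_colNorm Z r
    _ ≤ colNorm W * colNorm Z := by
        rw [← Finset.sum_mul]
        exact mul_le_mul_of_nonneg_right (sum_abs_le_colNorm W c) (colNorm_nonneg Z)

theorem rowNorm_CSP_le {N C : ℕ} {P : Fin C → Matrix (Fin N) (Fin N) ℝ}
    (hP : ∀ c, IsPermMatrix (P c)) (W : Matrix (Fin C) (Fin C) ℝ)
    (Z : Matrix (Fin N) (Fin C) ℝ) : rowNorm (CSP P W Z) ≤ C * colNorm W * rowNorm Z := by
  choose σ hσ using hP
  refine Real.iSup_le (fun n => ?_)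
    (mul_nonneg (mul_nonneg C.cast_nonneg (colNorm_nonneg _)) (rowNorm_nonneg _))
  calc ∑ c, |CSP P W Z n c| ≤ ∑ _c : Fin C, colNorm W * rowNorm Z := by
        gcongr with c
        calc |CSP P W Z n c| ≤ ∑ r, |Z ((σ c).symm n) r| * |W r c| := by
              simpa only [CSP_apply hσ, abs_mul] using
                Finset.abs_sum_le_sum_abs (fun r => Z ((σ c).symm n) r * W r c) Finset.univ
          _ ≤ ∑ r, rowNorm Z * |W r c| := by
              gcongr with r
              exact abs_le_rowNorm Z _ r
          _ ≤ colNorm W * rowNorm Z := by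
              rw [← Finset.mul_sum, mul_comm]
              exact mul_le_mul_of_nonneg_right (sum_abs_le_colNorm W c) (rowNorm_nonneg Z)
    _ = C * colNorm W * rowNorm Z := by simp [mul_assoc]

theorem r1_CSP_le {N C : ℕ} {P : Fin C → Matrix (Fin N) (Fin N) ℝ}
    (hP : ∀ c, IsPermMatrix (P c)) (W : Matrix (Fin C) (Fin C) ℝ)
    (X : Matrix (Fin N) (Fin C) ℝ) : r1 (CSP P W X) ≤ colNorm W * r1 X := by
  rw [r1.eq_1 X, Real.mul_iInf_of_nonneg (colNorm_nonneg W)]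
  refine le_ciInf fun x => (r1_le _ fun c => ∑ r, x r * W r c).trans ?_
  rw [CSP_sub_const hP]
  exact colNorm_CSP_le hP W _

theorem rInf_CSP_le {N C : ℕ} {P : Fin C → Matrix (Fin N) (Fin N) ℝ}
    (hP : ∀ c, IsPermMatrix (P c)) (W : Matrix (Fin C) (Fin C) ℝ)
    (X : Matrix (Fin N) (Fin C) ℝ) : rInf (CSP P W X) ≤ C * colNorm W * rInf X := by
  rw [rInf.eq_1 X, Real.mul_iInf_of_nonneg (mul_nonneg C.cast_nonneg (colNorm_nonneg W))]
  refine le_ciInf fun x => (rInf_le _ fun c => ∑ r, x r * W r c).trans ?_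
  rw [CSP_sub_const hP]
  exact rowNorm_CSP_le hP W _

/-- `r_{1,∞}(CSP_W(X)) ≤ √C · ‖W‖₁ · r_{1,∞}(X)`. -/
theorem stmt3 {N C : ℕ} (X : Matrix (Fin N) (Fin C) ℝ)
    (W : Matrix (Fin C) (Fin C) ℝ) (P : Fin C → Matrix (Fin N) (Fin N) ℝ)
    (hP : ∀ c, IsPermMatrix (P c)) :
    r1Inf (CSP P W X) ≤ Real.sqrt (C : ℝ) * colNorm W * r1Inf X := by
  have hW := colNorm_nonneg W
  calc r1Inf (CSP P W X)
      ≤ Real.sqrt (colNorm W * r1 X * (C * colNorm W * rInf X)) :=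
        Real.sqrt_le_sqrt <| mul_le_mul (r1_CSP_le hP W X) (rInf_CSP_le hP W X)
          (rInf_nonneg _) (mul_nonneg hW (r1_nonneg X))
    _ = Real.sqrt (C * colNorm W ^ 2 * (r1 X * rInf X)) := by ring_nf
    _ = Real.sqrt C * colNorm W * r1Inf X := by
        rw [Real.sqrt_mul (by positivity), Real.sqrt_mul C.cast_nonneg, Real.sqrt_sq hW, r1Inf]
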